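/- Let P be an n×n stochastic matrix, let ν be a probability vector on [n], let t ∈ ℕ, θ > 0, and i ∈ [n]. Then the probability that the Markov chain with transition matrix P started at i follows, during its first t steps, a path of weight greater than θ — namely Σ_{(i_0=i,i_1,…,i_t)∈[n]^{t+1}} (∏_{s=1}^t P(i_{s-1},i_s)) · 1{∏_{s=1}^t P(i_{s-1},i_s) > θ} — is at most ‖ν − P^t(i,·)‖_TV + sqrt( (1/θ) Σ_{j=1}^n ν(j)² ). -/

import Mathlib

open Filter
open scoped BigOperators Classical

/-- Weight of a trajectory `x = (x_0, …, x_t)`. -/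
noncomputable def pathWeight (n t : ℕ) (P : Fin n → Fin n → ℝ)
    (x : Fin (t + 1) → Fin n) : ℝ :=
  ∏ s : Fin t, P (x s.castSucc) (x s.succ)

/-- Quenched probability `Q_i(A)` for a property `A` of length-`t` trajectories. -/
noncomputable def quenched (n t : ℕ) (P : Fin n → Fin n → ℝ) (i : Fin n)
    (A : (Fin (t + 1) → Fin n) → Prop) : ℝ :=
  ∑ x : Fin (t + 1) → Fin n, if x 0 = i ∧ A x then pathWeight n t P x else 0

/-- `t`-th matrix power of a transition kernel. -/
noncomputable def matPow (n : ℕ) (P : Fin n → Fin n → ℝ) (t : ℕ) : Fin n → Fin n → ℝ :=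
  fun i j => ((Matrix.of P) ^ t) i j

/-- Total variation distance between two vectors on `[n]`. -/
noncomputable def tv (n : ℕ) (μ ν : Fin n → ℝ) : ℝ :=
  (1 / 2) * ∑ j : Fin n, |μ j - ν j|

theorem pathWeight_nonneg {n t : ℕ} {P : Fin n → Fin n → ℝ}
    (hP : ∀ i j, 0 ≤ P i j) (x : Fin (t + 1) → Fin n) : 0 ≤ pathWeight n t P x :=
  Finset.prod_nonneg fun _ _ => hP _ _

theorem pathWeight_cons {n t : ℕ} (P : Fin n → Fin n → ℝ) (a : Fin n)
    (y : Fin (t + 1) → Fin n) :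
    pathWeight n (t + 1) P (Fin.cons a y) = P a (y 0) * pathWeight n t P y := by
  simp only [pathWeight]
  rw [Fin.prod_univ_succ]
  simp only [Fin.castSucc_zero, Fin.cons_zero, Fin.cons_succ, ← Fin.succ_castSucc]

theorem quenched_term_nonneg {n t : ℕ} {P : Fin n → Fin n → ℝ} (hP : ∀ i j, 0 ≤ P i j)
    (i : Fin n) (A : (Fin (t + 1) → Fin n) → Prop) (x : Fin (t + 1) → Fin n) :
    0 ≤ if x 0 = i ∧ A x then pathWeight n t P x else 0 := by
  split_ifs
  exacts [pathWeight_nonneg hP x, le_rfl]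

theorem quenched_nonneg {n t : ℕ} {P : Fin n → Fin n → ℝ} (hP : ∀ i j, 0 ≤ P i j)
    (i : Fin n) (A : (Fin (t + 1) → Fin n) → Prop) : 0 ≤ quenched n t P i A :=
  Finset.sum_nonneg fun x _ => quenched_term_nonneg hP i A x

/-- If `A` contains only trajectories of weight at least `θ`, its probability is zero or at
least `θ`. -/
theorem le_quenched_of_ne_zero {n t : ℕ} {P : Fin n → Fin n → ℝ} (hP : ∀ i j, 0 ≤ P i j)
    (i : Fin n) {A : (Fin (t + 1) → Fin n) → Prop} {θ : ℝ}
    (hA : ∀ x, A x → θ ≤ pathWeight n t P x) (h : quenched n t P i A ≠ 0) :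
    θ ≤ quenched n t P i A := by
  obtain ⟨x, hx, hne⟩ := Finset.exists_ne_zero_of_sum_ne_zero h
  have hcond := (ite_ne_right_iff.1 hne).1
  have hle := Finset.single_le_sum (fun x _ => quenched_term_nonneg hP i A x) hx
  rw [if_pos hcond] at hle
  exact (hA x hcond.2).trans hle

theorem quenched_mono {n t : ℕ} {P : Fin n → Fin n → ℝ} (hP : ∀ i j, 0 ≤ P i j) (i : Fin n)
    {A B : (Fin (t + 1) → Fin n) → Prop} (hAB : ∀ x, A x → B x) :
    quenched n t P i A ≤ quenched n t P i B := by
  refine Finset.sum_le_sum fun x _ => ?_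
  by_cases h : x 0 = i ∧ A x
  · rw [if_pos h, if_pos ⟨h.1, hAB x h.2⟩]
  · rw [if_neg h]
    exact quenched_term_nonneg hP i B x

theorem sum_quenched_and_last {n t : ℕ} (P : Fin n → Fin n → ℝ) (i : Fin n)
    (A : (Fin (t + 1) → Fin n) → Prop) :
    ∑ j, quenched n t P i (fun x => A x ∧ x (Fin.last t) = j) = quenched n t P i A := by
  simp only [quenched]
  rw [Finset.sum_comm]
  refine Finset.sum_congr rfl fun x _ => ?_
  by_cases h : x 0 = i ∧ A x
  · simp [h.1, h.2]
  · rw [if_neg h]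
    exact Finset.sum_eq_zero fun j _ => if_neg fun h' => h ⟨h'.1, h'.2.1⟩

/-- The probability of ending at `j` after `t` steps is the `(i, j)` entry of the `t`-th power. -/
theorem quenched_last_eq_matPow {n : ℕ} (P : Fin n → Fin n → ℝ) (t : ℕ) (i j : Fin n) :
    quenched n t P i (fun x => x (Fin.last t) = j) = matPow n P t i j := by
  induction t generalizing i with
  | zero =>
    rw [quenched, ← (Equiv.funUnique (Fin 1) (Fin n)).symm.sum_comp]
    simp only [pathWeight, matPow, pow_zero, Matrix.one_apply, Finset.univ_eq_empty,
      Finset.prod_empty]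
    by_cases hij : i = j
    · subst hij; simp
    · rw [if_neg hij]
      refine Finset.sum_eq_zero fun a _ => if_neg ?_
      rintro ⟨rfl, h⟩
      exact hij h
  | succ t ih =>
    rw [matPow, pow_succ', Matrix.mul_apply]
    change _ = ∑ k, P i k * matPow n P t k j
    simp only [← ih]
    rw [quenched, ← (Fin.consEquiv fun _ : Fin (t + 2) => Fin n).sum_comp,
      Fintype.sum_prod_type, Finset.sum_eq_single i]
    · simp only [quenched, Finset.mul_sum]
      rw [Finset.sum_comm]
      refine Finset.sum_congr rfl fun y _ => ?_
      rw [Finset.sum_eq_single (y 0)]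
      · have hw : pathWeight n (t + 1) P (Fin.consEquiv (fun _ => Fin n) (i, y)) =
            P i (y 0) * pathWeight n t P y := pathWeight_cons P i y
        simp only [hw, Fin.consEquiv_apply, Fin.cons_zero, ← Fin.succ_last,
          Fin.cons_succ, true_and, mul_ite, mul_zero]
      · intro k _ hk
        simp [hk.symm]
      · simp
    · intro a _ ha
      refine Finset.sum_eq_zero fun y _ => if_neg ?_
      simp [ha]
    · simp

theorem sum_matPow {n : ℕ} {P : Fin n → Fin n → ℝ} (hrow : ∀ i, ∑ j, P i j = 1)
    (t : ℕ) (i : Fin n) : ∑ j, matPow n P t i j = 1 := by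
  induction t generalizing i with
  | zero => simp [matPow, Matrix.one_apply]
  | succ t ih =>
    have h : ∀ j, matPow n P (t + 1) i j = ∑ k, P i k * matPow n P t k j := fun j => by
      rw [matPow, pow_succ', Matrix.mul_apply]; rfl
    simp only [h]
    rw [Finset.sum_comm]
    simp only [← Finset.mul_sum, ih, mul_one, hrow]

theorem tv_eq_sum_max {n : ℕ} {μ ν : Fin n → ℝ} (h : ∑ j, μ j = ∑ j, ν j) :
    tv n μ ν = ∑ j, max (ν j - μ j) 0 := by
  have key : ∀ j, max (ν j - μ j) 0 = (1 / 2) * |μ j - ν j| + (1 / 2) * (ν j - μ j) := by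
    intro j
    rcases le_total (ν j) (μ j) with hj | hj
    · rw [max_eq_right (by linarith), abs_of_nonneg (by linarith)]; ring
    · rw [max_eq_left (by linarith), abs_of_nonpos (by linarith)]; ring
  simp only [key, Finset.sum_add_distrib, ← Finset.mul_sum, Finset.sum_sub_distrib, h, tv]
  ring

/-- If every nonzero value of a subprobability vector `p` is at least `θ`, then its overlap with
`ν` is controlled by the `ℓ²` norm of `ν`. -/
theorem sum_min_le_sqrt {ι : Type*} [Fintype ι] {p ν : ι → ℝ} {θ : ℝ} (hθ : 0 < θ)
    (hp0 : ∀ j, 0 ≤ p j) (hp1 : ∑ j, p j ≤ 1) (hp : ∀ j, p j ≠ 0 → θ ≤ p j) :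
    ∑ j, min (p j) (ν j) ≤ Real.sqrt ((1 / θ) * ∑ j, ν j ^ 2) := by
  set H := Finset.univ.filter fun j => p j ≠ 0
  have hcard : (H.card : ℝ) ≤ 1 / θ := by
    rw [le_div_iff₀ hθ]
    calc (H.card : ℝ) * θ = ∑ _j ∈ H, θ := by simp
      _ ≤ ∑ j ∈ H, p j := Finset.sum_le_sum fun j hj => hp j (Finset.mem_filter.1 hj).2
      _ ≤ ∑ j, p j := Finset.sum_le_univ_sum_of_nonneg hp0
      _ ≤ 1 := hp1
  have hmin : ∑ j, min (p j) (ν j) ≤ ∑ j ∈ H, ν j := by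
    rw [Finset.sum_filter]
    refine Finset.sum_le_sum fun j _ => ?_
    split_ifs with hj
    · exact min_le_right _ _
    · exact (min_le_left _ _).trans (not_not.1 hj).le
  refine hmin.trans (Real.le_sqrt_of_sq_le ?_)
  calc (∑ j ∈ H, ν j) ^ 2 ≤ H.card * ∑ j ∈ H, ν j ^ 2 := sq_sum_le_card_mul_sum_sq
    _ ≤ (1 / θ) * ∑ j, ν j ^ 2 :=
      mul_le_mul hcard (Finset.sum_le_univ_sum_of_nonneg fun j => sq_nonneg _)
        (Finset.sum_nonneg fun j _ => sq_nonneg _) (by positivity)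

theorem stmt7
    (n t : ℕ)
    (P : Fin n → Fin n → ℝ)
    (hnonneg : ∀ i j : Fin n, 0 ≤ P i j)
    (hrow : ∀ i : Fin n, ∑ j : Fin n, P i j = 1)
    (ν : Fin n → ℝ) (hν0 : ∀ j, 0 ≤ ν j) (hν1 : ∑ j : Fin n, ν j = 1)
    (θ : ℝ) (hθ : 0 < θ)
    (i : Fin n) :
    quenched n t P i (fun x => θ < pathWeight n t P x) ≤
      tv n ν (fun j => matPow n P t i j) +
        Real.sqrt ((1 / θ) * ∑ j : Fin n, (ν j) ^ 2) := by
  set p : Fin n → ℝ := fun j =>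
    quenched n t P i (fun x => θ < pathWeight n t P x ∧ x (Fin.last t) = j)
  have hsum : ∑ j, p j = quenched n t P i (fun x => θ < pathWeight n t P x) :=
    sum_quenched_and_last P i _
  have hple : ∀ j, p j ≤ matPow n P t i j := fun j =>
    (quenched_mono hnonneg i fun _ h => h.2).trans_eq (quenched_last_eq_matPow P t i j)
  have hp0 : ∀ j, 0 ≤ p j := fun j => quenched_nonneg hnonneg i _
  have hp1 : ∑ j, p j ≤ 1 :=
    (Finset.sum_le_sum fun j _ => hple j).trans_eq (sum_matPow hrow t i)
  have hpθ : ∀ j, p j ≠ 0 → θ ≤ p j := fun j =>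
    le_quenched_of_ne_zero hnonneg i fun _ h => h.1.le
  rw [← hsum, tv_eq_sum_max (hν1.trans (sum_matPow hrow t i).symm)]
  calc ∑ j, p j ≤ ∑ j, (max (matPow n P t i j - ν j) 0 + min (p j) (ν j)) := by
        refine Finset.sum_le_sum fun j _ => ?_
        rcases le_total (p j) (ν j) with hj | hj
        · rw [min_eq_left hj]
          linarith [le_max_right (matPow n P t i j - ν j) 0]
        · rw [min_eq_right hj]
          linarith [le_max_left (matPow n P t i j - ν j) 0, hple j]
    _ ≤ _ := by
        rw [Finset.sum_add_distrib]
        exact add_le_add le_rfl (sum_min_le_sqrt hθ hp0 hp1 hpθ)
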